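/- Let r ≥ 0 and let p, q ≥ 1 be coprime integers. Let G = F_r * (ℤ/pℤ) * (ℤ/qℤ) be the free product of a free group of rank r with cyclic groups of orders p and q, and let π : G → (ℤ/pℤ) × (ℤ/qℤ) be the homomorphism that sends every generator of the free factor F_r to 0 and maps the factors ℤ/pℤ and ℤ/qℤ by the canonical inclusions into the direct product. Then π is surjective and its kernel is a free group of rank pqr + (p−1)(q−1). -/

import Mathlib

/-- The factors of the free product `G = F_r * ℤ/pℤ * ℤ/qℤ`. -/
abbrev Fac (r p q : ℕ) : Unit ⊕ Unit ⊕ Unit → Type :=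
  Sum.elim (fun _ => FreeGroup (Fin r))
    (Sum.elim (fun _ => Multiplicative (ZMod p)) (fun _ => Multiplicative (ZMod q)))

instance (r p q : ℕ) (i : Unit ⊕ Unit ⊕ Unit) : Group (Fac r p q i) := by
  rcases i with _ | _ | _ <;> dsimp [Fac] <;> infer_instance

/-- The homomorphisms on the factors: the free factor `F_r` is sent to `1`, and the
cyclic factors `ℤ/pℤ` and `ℤ/qℤ` include canonically into `(ℤ/pℤ) × (ℤ/qℤ)`. -/
def facHom (r p q : ℕ) : ∀ i, Fac r p q i →* Multiplicative (ZMod p × ZMod q)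
  | Sum.inl _ => FreeGroup.lift fun _ => 1
  | Sum.inr (Sum.inl _) =>
      show Multiplicative (ZMod p) →* Multiplicative (ZMod p × ZMod q) from
        AddMonoidHom.toMultiplicative (AddMonoidHom.inl (ZMod p) (ZMod q))
  | Sum.inr (Sum.inr _) =>
      show Multiplicative (ZMod q) →* Multiplicative (ZMod p × ZMod q) from
        AddMonoidHom.toMultiplicative (AddMonoidHom.inr (ZMod p) (ZMod q))

/-- The homomorphism `π : F_r * ℤ/pℤ * ℤ/qℤ → (ℤ/pℤ) × (ℤ/qℤ)` killing the free factor
and including the cyclic factors. -/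
def piHom (r p q : ℕ) :
    Monoid.CoprodI (Fac r p q) →* Multiplicative (ZMod p × ZMod q) :=
  Monoid.CoprodI.lift (facHom r p q)

namespace KerFree

open scoped Classical in
/-- The (extended) commutator generators, trivial when one coordinate is trivial. -/
noncomputable def yy {A B J : Type} [Group A] [Group B] (a : A) (b : B) :
    FreeGroup ((A × B × J) ⊕ ({a : A // a ≠ 1} × {b : B // b ≠ 1})) :=
  if h : a ≠ 1 ∧ b ≠ 1 then FreeGroup.of (Sum.inr (⟨a, h.1⟩, ⟨b, h.2⟩)) else 1

abbrev FF (A B J : Type) [Group A] [Group B] : Type :=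
  FreeGroup ((A × B × J) ⊕ ({a : A // a ≠ 1} × {b : B // b ≠ 1}))

lemma yy_one_left {A B J : Type} [Group A] [Group B] (b : B) :
    (yy (1 : A) b : FF A B J) = 1 := by simp [yy]

lemma yy_one_right {A B J : Type} [Group A] [Group B] (a : A) :
    (yy a (1 : B) : FF A B J) = 1 := by simp [yy]

noncomputable def permA (A B J : Type) [Group A] [Group B] :
    A →* Equiv.Perm ((A × B) × FF A B J) where
  toFun a :=
    { toFun := fun w => ((a * w.1.1, w.1.2), w.2)
      invFun := fun w => ((a⁻¹ * w.1.1, w.1.2), w.2)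
      left_inv := fun w => by simp
      right_inv := fun w => by simp }
  map_one' := by ext w <;> simp
  map_mul' a b := by ext w <;> simp [mul_assoc]

noncomputable def permB (A B J : Type) [Group A] [Group B] :
    B →* Equiv.Perm ((A × B) × FF A B J) where
  toFun b :=
    { toFun := fun w => ((w.1.1, b * w.1.2), yy w.1.1 (b * w.1.2) * (yy w.1.1 w.1.2)⁻¹ * w.2)
      invFun := fun w =>
        ((w.1.1, b⁻¹ * w.1.2), yy w.1.1 (b⁻¹ * w.1.2) * (yy w.1.1 w.1.2)⁻¹ * w.2)
      left_inv := fun w => by simp [mul_assoc]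
      right_inv := fun w => by simp [mul_assoc] }
  map_one' := by ext w <;> simp
  map_mul' a b := by ext w <;> simp [mul_assoc]

noncomputable def permJ (A B J : Type) [Group A] [Group B] (j : J) :
    Equiv.Perm ((A × B) × FF A B J) where
  toFun w := (w.1, FreeGroup.of (Sum.inl (w.1.1, w.1.2, j)) * w.2)
  invFun w := (w.1, (FreeGroup.of (Sum.inl (w.1.1, w.1.2, j)))⁻¹ * w.2)
  left_inv w := by simp
  right_inv w := by simp

theorem main {G A B J : Type} [Group G] [Group A] [Group B]
    (iA : A →* G) (iB : B →* G) (t : J → G) (π : G →* A × B)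
    (hA : ∀ a, π (iA a) = (a, 1)) (hB : ∀ b, π (iB b) = (1, b)) (ht : ∀ j, π (t j) = 1)
    (hgen : ∀ H : Subgroup G, (∀ a, iA a ∈ H) → (∀ b, iB b ∈ H) → (∀ j, t j ∈ H) → H = ⊤)
    (Θ : G →* Equiv.Perm ((A × B) × FF A B J))
    (tA : ∀ a, Θ (iA a) = permA A B J a) (tB : ∀ b, Θ (iB b) = permB A B J b)
    (tt : ∀ j, Θ (t j) = permJ A B J j) :
    Nonempty (π.ker ≃* FF A B J) := by
  let φ : FF A B J →* G := FreeGroup.lift (Sum.elim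
    (fun x => (iA x.1 * iB x.2.1)⁻¹ * t x.2.2 * (iA x.1 * iB x.2.1))
    (fun x => (iB x.2.1)⁻¹ * (iA x.1.1)⁻¹ * iB x.2.1 * iA x.1.1))
  have φy : ∀ a b, φ (yy a b) = (iB b)⁻¹ * (iA a)⁻¹ * iB b * iA a := by
    intro a b
    unfold yy
    split_ifs with h
    · simp [φ]
    · by_cases ha : a = 1
      · simp [ha]
      · have : b = 1 := by by_contra hb; exact h ⟨ha, hb⟩
        simp [this]
  have φz : ∀ a b j, φ (FreeGroup.of (Sum.inl (a, b, j))) =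
      (iA a * iB b)⁻¹ * t j * (iA a * iB b) := by
    intro a b j; simp [φ]
  let E : (A × B) × FF A B J → G := fun w => iA w.1.1 * iB w.1.2 * φ w.2
  have hE : ∀ g w, E (Θ g w) = g * E w := by
    let H : Subgroup G :=
      { carrier := {g | ∀ w, E (Θ g w) = g * E w}
        one_mem' := by intro w; simp
        mul_mem' := by
          intro a b ha hb w
          rw [map_mul, Equiv.Perm.mul_apply, ha, hb, mul_assoc]
        inv_mem' := by
          intro a ha w
          have := ha (Θ a⁻¹ w)
          rw [← Equiv.Perm.mul_apply, ← map_mul] at this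
          simp only [mul_inv_cancel, map_one, Equiv.Perm.one_apply] at this
          rw [this]; simp }
    have hH : H = ⊤ := by
      apply hgen
      · intro a w
        rw [tA]
        simp [E, permA, mul_assoc]
      · intro b w
        rw [tB]
        simp [E, permB, mul_assoc, φy]
      · intro b w
        rw [tt]
        simp [E, permJ, mul_assoc, φz]
    intro g
    have : g ∈ H := hH ▸ Subgroup.mem_top g
    exact this
  have hΘ : ∀ f h, Θ (φ f) ((1, 1), h) = ((1, 1), f * h) := by
    intro f
    induction f using FreeGroup.induction_on with
    | C1 => intro h; simp
    | of x =>
      intro h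
      rcases x with ⟨a, b, j⟩ | ⟨⟨a, ha⟩, ⟨b, hb⟩⟩
      · rw [φz]
        simp only [map_mul, map_inv, tA, tB, tt, Equiv.Perm.mul_apply]
        rw [Equiv.Perm.inv_eq_iff_eq]
        simp [permA, permB, permJ, yy_one_left]
      · have h1 : (FreeGroup.of (Sum.inr (⟨a, ha⟩, ⟨b, hb⟩)) : FF A B J) = yy a b := by
          simp [yy, ha, hb]
        change Θ (φ (FreeGroup.of (Sum.inr (⟨a, ha⟩, ⟨b, hb⟩)))) _ =
          (_, (FreeGroup.of (Sum.inr (⟨a, ha⟩, ⟨b, hb⟩))) * h)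
        rw [h1, φy]
        simp only [map_mul, map_inv, tA, tB, ← mul_inv_rev, Equiv.Perm.mul_apply]
        rw [Equiv.Perm.inv_eq_iff_eq]
        simp [permA, permB, yy_one_left, yy_one_right]
    | inv_of x ih =>
      intro h
      rw [map_inv, map_inv, Equiv.Perm.inv_eq_iff_eq]
      have := ih ((FreeGroup.of x)⁻¹ * h)
      rw [mul_inv_cancel_left] at this
      exact this.symm
    | mul x y hx hy =>
      intro h
      rw [map_mul, map_mul, Equiv.Perm.mul_apply, hy, hx, mul_assoc]
  have hπφ : ∀ f, π (φ f) = 1 := by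
    intro f
    have : π.comp φ = 1 := by
      ext x
      all_goals
        rcases x with ⟨a, b, j⟩ | ⟨⟨a, ha⟩, ⟨b, hb⟩⟩ <;> simp [φ, hA, hB, ht]
    exact DFunLike.congr_fun this f
  let ψ : FF A B J →* π.ker := φ.codRestrict π.ker hπφ
  refine ⟨(MulEquiv.ofBijective ψ ⟨?_, ?_⟩).symm⟩
  · intro f f' hff
    have h0 : φ f = φ f' := congrArg Subtype.val hff
    have h1 := hΘ f 1
    rw [h0, hΘ f' 1] at h1
    simpa using h1.symm
  · rintro ⟨g, hg⟩
    have h1 := hE g ((1, 1), 1)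
    set w := Θ g ((1, 1), 1) with hw
    have h2 : iA w.1.1 * iB w.1.2 * φ w.2 = g := by simpa [E] using h1
    have h3 : π g = w.1 := by
      rw [← h2]; simp [hA, hB, hπφ]
    have h4 : w.1 = 1 := h3.symm.trans hg
    refine ⟨w.2, Subtype.ext ?_⟩
    change φ w.2 = g
    rw [← h2, h4]; simp

lemma card_ne (A : Type) [Group A] [Finite A] {n : ℕ} (h : Nat.card A = n) :
    Nat.card {a : A // a ≠ 1} = n - 1 := by
  classical
  have := Fintype.ofFinite A
  rw [← h, Nat.card_eq_fintype_card, Nat.card_eq_fintype_card]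
  exact Set.card_ne_eq (1 : A)

end KerFree

/-- For `r ≥ 0` and coprime `p, q ≥ 1`, the homomorphism
`π : F_r * ℤ/pℤ * ℤ/qℤ → (ℤ/pℤ) × (ℤ/qℤ)` is surjective and its kernel is a free group
of rank `pqr + (p-1)(q-1)`. -/
theorem stmt19 (r p q : ℕ) (hp : 1 ≤ p) (hq : 1 ≤ q) (hpq : Nat.Coprime p q) :
    Function.Surjective (piHom r p q) ∧
    Nonempty ((MonoidHom.ker (piHom r p q)) ≃*
      FreeGroup (Fin (p * q * r + (p - 1) * (q - 1)))) := by
  let A := Multiplicative (ZMod p)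
  let B := Multiplicative (ZMod q)
  let iF : FreeGroup (Fin r) →* Monoid.CoprodI (Fac r p q) :=
    Monoid.CoprodI.of (M := Fac r p q) (i := Sum.inl ())
  let iA : A →* Monoid.CoprodI (Fac r p q) :=
    Monoid.CoprodI.of (M := Fac r p q) (i := Sum.inr (Sum.inl ()))
  let iB : B →* Monoid.CoprodI (Fac r p q) :=
    Monoid.CoprodI.of (M := Fac r p q) (i := Sum.inr (Sum.inr ()))
  let e : Multiplicative (ZMod p × ZMod q) ≃* A × B := MulEquiv.prodMultiplicative _ _
  have pA : ∀ a : A, piHom r p q (iA a) = Multiplicative.ofAdd (a.toAdd, 0) := fun a =>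
    Monoid.CoprodI.lift_of (M := Fac r p q) (facHom r p q) (i := Sum.inr (Sum.inl ())) a
  have pB : ∀ b : B, piHom r p q (iB b) = Multiplicative.ofAdd (0, b.toAdd) := fun b =>
    Monoid.CoprodI.lift_of (M := Fac r p q) (facHom r p q) (i := Sum.inr (Sum.inr ())) b
  have pF : ∀ f, piHom r p q (iF f) = FreeGroup.lift (fun _ => 1) f := fun f =>
    Monoid.CoprodI.lift_of (M := Fac r p q) (facHom r p q) (i := Sum.inl ()) f
  constructor
  · intro x
    refine ⟨iA (Multiplicative.ofAdd x.toAdd.1) * iB (Multiplicative.ofAdd x.toAdd.2), ?_⟩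
    rw [map_mul, pA, pB]
    rw [← ofAdd_add]
    simp
  have : NeZero p := ⟨by omega⟩
  have : NeZero q := ⟨by omega⟩
  let Th : ∀ i, Fac r p q i →* Equiv.Perm ((A × B) × KerFree.FF A B (Fin r)) := fun i =>
    match i with
    | Sum.inl _ => FreeGroup.lift (KerFree.permJ A B (Fin r))
    | Sum.inr (Sum.inl _) => KerFree.permA A B (Fin r)
    | Sum.inr (Sum.inr _) => KerFree.permB A B (Fin r)
  obtain ⟨m⟩ := KerFree.main iA iB (fun j => iF (FreeGroup.of j))
    (e.toMonoidHom.comp (piHom r p q))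
    (fun a => by
      change e (piHom r p q (iA a)) = _
      rw [pA]; rfl)
    (fun b => by
      change e (piHom r p q (iB b)) = _
      rw [pB]; rfl)
    (fun j => by
      change e (piHom r p q (iF _)) = _
      rw [pF]; simp)
    (by
      intro H h1 h2 h3
      rw [eq_top_iff]
      rintro g -
      induction g using Monoid.CoprodI.induction_on with
      | one => exact H.one_mem
      | of i m =>
        rcases i with ⟨⟩ | ⟨⟩ | ⟨⟩
        · change iF m ∈ H
          change FreeGroup (Fin r) at m
          induction m using FreeGroup.induction_on with
          | C1 => rw [map_one]; exact H.one_mem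
          | of x => exact h3 x
          | inv_of x ih => rw [map_inv]; exact H.inv_mem (h3 x)
          | mul x y hx hy => rw [map_mul]; exact H.mul_mem hx hy
        · exact h1 m
        · exact h2 m
      | mul x y hx hy => exact H.mul_mem hx hy)
    (Monoid.CoprodI.lift Th)
    (fun a => Monoid.CoprodI.lift_of (M := Fac r p q) Th (i := Sum.inr (Sum.inl ())) a)
    (fun b => Monoid.CoprodI.lift_of (M := Fac r p q) Th (i := Sum.inr (Sum.inr ())) b)
    (fun j => (Monoid.CoprodI.lift_of (M := Fac r p q) Th (i := Sum.inl ())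
      (FreeGroup.of j)).trans (FreeGroup.lift_apply_of))
  have hk : (e.toMonoidHom.comp (piHom r p q)).ker = (piHom r p q).ker := by
    ext g
    simp [MonoidHom.mem_ker]
  have : Fintype A := Fintype.ofEquiv (ZMod p) Multiplicative.ofAdd
  have : Fintype B := Fintype.ofEquiv (ZMod q) Multiplicative.ofAdd
  have cA : Nat.card A = p := Nat.card_zmod p
  have cB : Nat.card B = q := Nat.card_zmod q
  have cc : Nat.card ((A × B × Fin r) ⊕ ({a : A // a ≠ 1} × {b : B // b ≠ 1})) =
      p * q * r + (p - 1) * (q - 1) := by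
    classical
    rw [Nat.card_sum, Nat.card_prod, Nat.card_prod, Nat.card_prod, cA, cB, Nat.card_fin]
    have h1 : Nat.card {a : A // a ≠ 1} = p - 1 := KerFree.card_ne A cA
    have h2 : Nat.card {a : B // a ≠ 1} = q - 1 := KerFree.card_ne B cB
    rw [h1, h2, mul_assoc]
  exact ⟨(MulEquiv.subgroupCongr hk).symm.trans
    (m.trans (FreeGroup.freeGroupCongr (Finite.equivFinOfCardEq cc)))⟩
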